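/- Let φ be a fractional routing of a finite family H of demands on the bidirected ring on n ≥ 2 nodes, and let f1 = (s1,t1) and f2 = (s2,t2) be two distinct demands such that (f1,f2) is parallel, witnessed by integers 1 ≤ a ≤ b < g ≤ n with t1 = s1 + a, t2 = s1 + b, s2 = s1 + g. Let x1 = (1−φ(f1))·d(f1), x2 = φ(f2)·d(f2), and m = min(x1, x2), and define φ' by φ'(f1) = φ(f1) + m/d(f1), φ'(f2) = φ(f2) − m/d(f2), and φ'(f) = φ(f) for all other demands f. Then φ' is a fractional routing (all its values lie in [0,1]), the load of φ' on every edge of the ring is at most the load of φ on that edge, and at least one of f1, f2 is not split under φ'. -/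

import Mathlib

open Finset

/-- A demand on the bidirected ring on `n` nodes: a pair of distinct nodes together
with a positive demand value. -/
structure Demand (n : ℕ) where
  s : ZMod n
  t : ZMod n
  hst : s ≠ t
  d : ℝ
  hd : 0 < d

/-- The forward edge `F i` (from `i` to `i+1`) lies on the forward path from `s` to `t`. -/
def OnFwdPath (n : ℕ) (s t i : ZMod n) : Prop :=
  (i - s).val < (t - s).val

/-- The backward edge `B i` (from `i+1` to `i`) lies on the backward path from `s` to `t`. -/
def OnBwdPath (n : ℕ) (s t i : ZMod n) : Prop :=
  (t - s).val ≤ (i - s).val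

instance (n : ℕ) (s t i : ZMod n) : Decidable (OnFwdPath n s t i) :=
  inferInstanceAs (Decidable (_ < _))

instance (n : ℕ) (s t i : ZMod n) : Decidable (OnBwdPath n s t i) :=
  inferInstanceAs (Decidable (_ ≤ _))

/-- An edge of the bidirected ring: `(true, i)` is the forward edge `F i`
(from `i` to `i+1`), and `(false, i)` is the backward edge `B i` (from `i+1` to `i`). -/
abbrev RingEdge (n : ℕ) := Bool × ZMod n

/-- The load of a routing `φ` of the family of demands `f` on an edge of the ring. -/
def edgeLoad {n : ℕ} {ι : Type*} [Fintype ι] (f : ι → Demand n) (φ : ι → ℝ) :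
    RingEdge n → ℝ
  | (true, i) => ∑ a, if OnFwdPath n (f a).s (f a).t i then φ a * (f a).d else 0
  | (false, i) => ∑ a, if OnBwdPath n (f a).s (f a).t i then (1 - φ a) * (f a).d else 0

/-- `φ` is a fractional routing: all its values lie in `[0,1]`. -/
def IsFracRouting {ι : Type*} (φ : ι → ℝ) : Prop := ∀ a, 0 ≤ φ a ∧ φ a ≤ 1

/-- `φ` is an integral routing: each demand is routed entirely forward or entirely backward. -/
def IsIntRouting {ι : Type*} (φ : ι → ℝ) : Prop := ∀ a, φ a = 0 ∨ φ a = 1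

/-- The demand indexed by `a` is split under `φ`. -/
def IsSplit {ι : Type*} (φ : ι → ℝ) (a : ι) : Prop := 0 < φ a ∧ φ a < 1

/-- Demands `f1 = (s1,t1)` and `f2 = (s2,t2)` are parallel (in this order): there are
integers `1 ≤ a ≤ b < g ≤ n` with `t1 = s1 + a`, `t2 = s1 + b`, `s2 = s1 + g`. -/
def Parallel (n : ℕ) (f1 f2 : Demand n) : Prop :=
  ∃ a b g : ℕ, 1 ≤ a ∧ a ≤ b ∧ b < g ∧ g ≤ n ∧
    f1.t = f1.s + (a : ZMod n) ∧ f2.t = f1.s + (b : ZMod n) ∧ f2.s = f1.s + (g : ZMod n)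

/-- If `(s, s + a)` and `(s + g, s + b)` are parallel, then the forward path of the first
pair is contained in the forward path of the second. -/
theorem OnFwdPath.of_parallel {n : ℕ} {s t s' t' i : ZMod n} {a b g : ℕ}
    (hab : a ≤ b) (hbg : b < g) (hgn : g ≤ n)
    (ht : t = s + (a : ZMod n)) (ht' : t' = s + (b : ZMod n)) (hs' : s' = s + (g : ZMod n))
    (h : OnFwdPath n s t i) : OnFwdPath n s' t' i := by
  have : NeZero n := ⟨by omega⟩
  unfold OnFwdPath at h ⊢
  have hta : (t - s).val = a := by
    rw [ht, add_sub_cancel_left, ZMod.val_natCast_of_lt (by omega)]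
  rw [hta] at h
  have shift : ∀ k : ℕ, k < g → (s + (k : ZMod n) - s').val = k + (n - g) := by
    intro k hk
    have hcast : s + (k : ZMod n) - s' = ((k + (n - g) : ℕ) : ZMod n) := by
      rw [hs']
      push_cast [Nat.cast_sub hgn, ZMod.natCast_self]
      ring
    rw [hcast, ZMod.val_natCast_of_lt (by omega)]
  have hi : i = s + (((i - s).val : ℕ) : ZMod n) := by
    rw [ZMod.natCast_zmod_val]
    ring
  rw [ht', shift b hbg, hi, shift _ (by omega)]
  omega

theorem onBwdPath_iff_not_onFwdPath {n : ℕ} {s t i : ZMod n} :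
    OnBwdPath n s t i ↔ ¬ OnFwdPath n s t i :=
  not_lt.symm

/-- Sums of functions that agree outside two points compare as their sums over these points. -/
theorem sum_le_sum_of_eq_off_pair {ι : Type*} [Fintype ι] {u v : ι → ℝ} {x y : ι}
    (hxy : x ≠ y) (hoff : ∀ c, c ≠ x → c ≠ y → u c = v c) (hle : u x + u y ≤ v x + v y) :
    ∑ c, u c ≤ ∑ c, v c := by
  have h : ∑ c, (v c - u c) = (v x - u x) + (v y - u y) :=
    Fintype.sum_eq_add x y hxy fun c hc => sub_eq_zero.2 (hoff c hc.1 hc.2).symm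
  rw [Finset.sum_sub_distrib] at h
  linarith

/-- Uncrossing a pair of parallel split demands does not increase any load,
keeps the routing fractional, and unsplits at least one of the two demands. -/
theorem stmt1 (n : ℕ) (hn : 2 ≤ n) {ι : Type*} [Fintype ι] [DecidableEq ι]
    (f : ι → Demand n) (φ : ι → ℝ) (hφ : IsFracRouting φ)
    (a1 a2 : ι) (h12 : a1 ≠ a2)
    (a b g : ℕ) (ha : 1 ≤ a) (hab : a ≤ b) (hbg : b < g) (hgn : g ≤ n)
    (ht1 : (f a1).t = (f a1).s + (a : ZMod n))
    (ht2 : (f a2).t = (f a1).s + (b : ZMod n))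
    (hs2 : (f a2).s = (f a1).s + (g : ZMod n)) :
    let x1 := (1 - φ a1) * (f a1).d
    let x2 := φ a2 * (f a2).d
    let m := min x1 x2
    let φ' : ι → ℝ := fun a' =>
      if a' = a1 then φ a1 + m / (f a1).d
      else if a' = a2 then φ a2 - m / (f a2).d
      else φ a'
    IsFracRouting φ' ∧ (∀ e, edgeLoad f φ' e ≤ edgeLoad f φ e) ∧
      (¬ IsSplit φ' a1 ∨ ¬ IsSplit φ' a2) := by
  intro x1 x2 m φ'
  have hd1 := (f a1).hd
  have hd2 := (f a2).hd
  have hm0 : 0 ≤ m := le_min (mul_nonneg (by linarith [(hφ a1).2]) hd1.le)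
    (mul_nonneg (hφ a2).1 hd2.le)
  have hφ1 : φ' a1 = φ a1 + m / (f a1).d := if_pos rfl
  have hφ2 : φ' a2 = φ a2 - m / (f a2).d := by simp [φ', h12.symm]
  have hφ3 : ∀ c, c ≠ a1 → c ≠ a2 → φ' c = φ c := fun c h1 h2 => by simp [φ', h1, h2]
  have hq1 : 0 ≤ m / (f a1).d := div_nonneg hm0 hd1.le
  have hq2 : 0 ≤ m / (f a2).d := div_nonneg hm0 hd2.le
  have hm1 : m / (f a1).d ≤ 1 - φ a1 := (div_le_iff₀ hd1).2 (min_le_left _ _)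
  have hm2 : m / (f a2).d ≤ φ a2 := (div_le_iff₀ hd2).2 (min_le_right _ _)
  have hmul1 : φ' a1 * (f a1).d = φ a1 * (f a1).d + m := by
    rw [hφ1, add_mul, div_mul_cancel₀ _ hd1.ne']
  have hmul2 : φ' a2 * (f a2).d = φ a2 * (f a2).d - m := by
    rw [hφ2, sub_mul, div_mul_cancel₀ _ hd2.ne']
  refine ⟨fun c => ?_, ?_, ?_⟩
  · by_cases h1 : c = a1
    · subst h1
      rw [hφ1]
      constructor <;> linarith [(hφ c).1]
    · by_cases h2 : c = a2
      · subst h2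
        rw [hφ2]
        constructor <;> linarith [(hφ c).2]
      · rw [hφ3 c h1 h2]
        exact hφ c
  · rintro ⟨_ | _, i⟩
    all_goals
      have hpath : OnFwdPath n (f a1).s (f a1).t i → OnFwdPath n (f a2).s (f a2).t i :=
        OnFwdPath.of_parallel hab hbg hgn ht1 ht2 hs2
      refine sum_le_sum_of_eq_off_pair h12 (fun c h1 h2 => by rw [hφ3 c h1 h2]) ?_
    · simp only [onBwdPath_iff_not_onFwdPath, sub_mul, hmul1, hmul2]
      split_ifs <;> first | linarith | tauto
    · simp only [hmul1, hmul2]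
      split_ifs <;> first | linarith | tauto
  · rcases min_choice x1 x2 with h | h
    · left
      have : φ' a1 = 1 := by
        rw [hφ1, show m = (1 - φ a1) * (f a1).d from h, mul_div_cancel_right₀ _ hd1.ne']
        ring
      exact fun hs => hs.2.ne this
    · right
      have : φ' a2 = 0 := by
        rw [hφ2, show m = φ a2 * (f a2).d from h, mul_div_cancel_right₀ _ hd2.ne', sub_self]
      exact fun hs => hs.1.ne' this
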